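/- Let r be a real number with 0 < r < 1, and for N ∈ ℕ let S_N := Σ_{k=0}^{N−1} (−1)^k · (r)_k² · (1 + r/2)_k · (1/2)_k² / ((r/2)_k · (r + 1/2)_k² · (k!)²), the N-th partial sum of the very well-poised series 5F4(r, 1 + r/2, r, 1/2, 1/2; r/2, 1, r + 1/2, r + 1/2; −1). Then the sequence (S_N) converges, and B(r, 1 − r) · B(r, 1/2)² · lim_{N→∞} S_N = −2^{−2r} · B(−r/2, r) · B(1/2, 1/2) · B((1 − r)/2, r) · 3F2(1/2, 1/2, (1 − r)/2; 1, (1 + r)/2; 1). -/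

import Mathlib

open Real

/-- Ascending Pochhammer symbol `(x)_k = x(x+1)⋯(x+k−1)`. -/
noncomputable def poch (x : ℝ) (k : ℕ) : ℝ := (ascPochhammer ℝ k).eval x

/-- The Beta function quotient `B(x,y) = Γ(x)Γ(y)/Γ(x+y)`. -/
noncomputable def betaR (x y : ℝ) : ℝ := Gamma x * Gamma y / Gamma (x + y)

/-- Generalized hypergeometric series `₃F₂(a₁,a₂,a₃; b₁,b₂; z)`. -/
noncomputable def F32 (a1 a2 a3 b1 b2 z : ℝ) : ℝ :=
  ∑' k : ℕ, (poch a1 k * poch a2 k * poch a3 k)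
      / (poch b1 k * poch b2 k * (k.factorial : ℝ)) * z ^ k

/-- The hypergeometric period value `P(r,s) = π · B(r, s−r) · ₃F₂(1/2,1/2,r; 1,s; 1)`. -/
noncomputable def P (r s : ℝ) : ℝ := π * betaR r (s - r) * F32 (1/2) (1/2) r 1 s 1

open Filter Topology

lemma poch_zero (x : ℝ) : poch x 0 = 1 := by simp [poch]

lemma poch_succ (x : ℝ) (k : ℕ) : poch x (k + 1) = poch x k * (x + k) := by
  simp [poch, ascPochhammer_succ_eval]

lemma poch_pos {x : ℝ} (hx : 0 < x) (k : ℕ) : 0 < poch x k :=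
  ascPochhammer_pos k x hx

lemma poch_one (k : ℕ) : poch 1 k = (k.factorial : ℝ) := by
  simp [poch]

lemma poch_add (x : ℝ) (m n : ℕ) : poch x (m + n) = poch x m * poch (x + m) n := by
  induction n with
  | zero => simp [poch_zero]
  | succ n ih => rw [← add_assoc, poch_succ, poch_succ, ih]; push_cast; ring

lemma mul_poch_one_add (x : ℝ) (n : ℕ) : x * poch (1 + x) n = poch x n * (x + n) := by
  rw [← poch_succ, add_comm n, poch_add]
  simp [poch_succ, poch_zero, add_comm]

lemma choose_eq_succ_choose (k j : ℕ) (hj : j ≤ k + 1) :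
    (k.choose j : ℝ) = (k + 1).choose j * (k + 1 - j) / (k + 1) := by
  have h := Nat.choose_mul_succ_eq k j
  have h' : (k.choose j : ℝ) * (k + 1) = (k + 1).choose j * (k + 1 - j) := by
    rw [← Nat.cast_add_one, ← Nat.cast_sub hj]; exact_mod_cast h
  rw [← h']; field_simp

lemma choose_succ_eq (k j : ℕ) (hj : j ≤ k) :
    (k.choose (j + 1) : ℝ) = k.choose j * (k - j) / (j + 1) := by
  have h := Nat.choose_succ_right_eq k j
  have h' : (k.choose (j + 1) : ℝ) * (j + 1) = k.choose j * (k - j) := by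
    rw [← Nat.cast_add_one, ← Nat.cast_sub hj]; exact_mod_cast h
  rw [← h']; field_simp

/-- A balanced terminating `₃F₂` at `1`, a case of the Pfaff–Saalschütz theorem. -/
lemma sum_saalschutz {r : ℝ} (hr : 0 < r) (k : ℕ) :
    ∑ j ∈ Finset.range (k + 1), (-1 : ℝ) ^ j * k.choose j * poch r (k + j)
        * poch ((1 - r) / 2) j / (j.factorial * poch ((1 + r) / 2) j)
      = poch r k ^ 2 / k.factorial := by
  induction k with
  | zero => simp [poch_zero]
  | succ k ih =>
    set F : ℕ → ℕ → ℝ := fun k j => (-1 : ℝ) ^ j * k.choose j * poch r (k + j)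
        * poch ((1 - r) / 2) j / (j.factorial * poch ((1 + r) / 2) j) with hF
    set G : ℕ → ℝ := fun j => -2 * ((-1 : ℝ) ^ j * (k + 1).choose j * poch r (k + j)
        * poch ((1 - r) / 2) j / (j.factorial * poch ((1 + r) / 2) j))
        * (j ^ 2 * ((1 + r) / 2 + j - 1) / (k + 1)) with hG
    have hterm : ∀ j ∈ Finset.range (k + 2),
        (k + 1) * F (k + 1) j - (r + k) ^ 2 * F k j = G (j + 1) - G j := by
      intro j hj
      have hj' : j ≤ k + 1 := by simpa [Nat.lt_succ_iff] using hj
      have hq : poch ((1 + r) / 2) j ≠ 0 := (poch_pos (by linarith) j).ne'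
      have hq' : (1 + r) / 2 + j ≠ 0 := by positivity
      have hf : (j.factorial : ℝ) ≠ 0 := by positivity
      have hk : (k : ℝ) + 1 ≠ 0 := by positivity
      have hj1 : (j : ℝ) + 1 ≠ 0 := by positivity
      simp only [hF, hG]
      rw [choose_eq_succ_choose k j hj', choose_succ_eq (k + 1) j hj',
        show k + 1 + j = k + j + 1 by ring, show k + (j + 1) = k + j + 1 by ring,
        poch_succ, poch_succ, poch_succ, Nat.factorial_succ, pow_succ]
      push_cast

      field_simp
      ring
    have hsum := Finset.sum_congr rfl hterm
    rw [Finset.sum_range_sub, Finset.sum_sub_distrib, ← Finset.mul_sum, ← Finset.mul_sum,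
      Finset.sum_range_succ (F k)] at hsum
    have h0 : F k (k + 1) = 0 := by simp [hF]
    have h1 : G (k + 2) = 0 := by simp [hG]
    have h2 : G 0 = 0 := by simp [hG]
    rw [h0, h1, h2, ih] at hsum
    have hf : (k.factorial : ℝ) ≠ 0 := by positivity
    have hk : (k : ℝ) + 1 ≠ 0 := by positivity
    rw [poch_succ, Nat.factorial_succ]
    push_cast
    rw [eq_div_iff (by positivity)]
    field_simp at hsum
    linear_combination hsum

/-- The terminating very well-poised `₅F₄` at `1` with two equal parameters. -/
lemma sum_veryWellPoised {A d c s : ℝ} (hA : 0 < A) (hc : 0 < c)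
    (hcA : c = 1 + A - d) (hs : s = 1 + A - 2 * d) (m : ℕ) :
    ∑ i ∈ Finset.range (m + 1), (-1 : ℝ) ^ i * m.choose i * poch A i * (A + 2 * i)
        * poch d i ^ 2 / (poch c i ^ 2 * poch (1 + A) (m + i))
      = A * poch s m / poch c m ^ 2 := by
  induction m with
  | zero => simp [poch_zero]
  | succ m ih =>
    set F : ℕ → ℕ → ℝ := fun m i => (-1 : ℝ) ^ i * m.choose i * poch A i * (A + 2 * i)
        * poch d i ^ 2 / (poch c i ^ 2 * poch (1 + A) (m + i)) with hF
    set G : ℕ → ℝ := fun i => - ((-1 : ℝ) ^ i * (m + 1).choose i * poch A i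
        * poch d i ^ 2 / (poch c i ^ 2 * poch (1 + A) (m + i)))
        * (i * (c + i - 1) ^ 2 / (m + 1)) with hG
    have hterm : ∀ i ∈ Finset.range (m + 2),
        (c + m) ^ 2 * F (m + 1) i - (s + m) * F m i = G (i + 1) - G i := by
      intro i hi
      have hi' : i ≤ m + 1 := by simpa [Nat.lt_succ_iff] using hi
      have hq : poch c i ≠ 0 := (poch_pos hc i).ne'
      have hq' : c + i ≠ 0 := by positivity
      have hA1 : poch (1 + A) (m + i) ≠ 0 := (poch_pos (by linarith) _).ne'
      have hA2 : 1 + A + (m + i) ≠ 0 := by positivity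
      have hm : (m : ℝ) + 1 ≠ 0 := by positivity
      have hi1 : (i : ℝ) + 1 ≠ 0 := by positivity
      simp only [hF, hG]
      rw [choose_eq_succ_choose m i hi', choose_succ_eq (m + 1) i hi',
        show m + 1 + i = m + i + 1 by ring, show m + (i + 1) = m + i + 1 by ring,
        poch_succ, poch_succ, poch_succ, poch_succ, pow_succ]
      push_cast
      subst hcA hs
      field_simp
      ring
    have hsum := Finset.sum_congr rfl hterm
    rw [Finset.sum_range_sub, Finset.sum_sub_distrib, ← Finset.mul_sum, ← Finset.mul_sum,
      Finset.sum_range_succ (F m)] at hsum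
    have h0 : F m (m + 1) = 0 := by simp [hF]
    have h1 : G (m + 2) = 0 := by simp [hG]
    have h2 : G 0 = 0 := by simp [hG]
    rw [h0, h1, h2, ih] at hsum
    have hq : poch c m ≠ 0 := (poch_pos hc m).ne'
    have hq' : c + m ≠ 0 := by positivity
    rw [poch_succ, poch_succ, eq_div_iff (by positivity)]
    field_simp at hsum
    linear_combination hsum

/-- The summand of the very well-poised `₅F₄`, without its sign. -/
noncomputable def wellPoisedTerm (r : ℝ) (k : ℕ) : ℝ :=
  poch r k ^ 2 * poch (1 / 2) k ^ 2 * (r + 2 * k) / (r * poch (r + 1 / 2) k ^ 2 * k.factorial ^ 2)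

/-- The summand of the `₃F₂(1/2, 1/2, (1 - r)/2; 1, (1 + r)/2; 1)`. -/
noncomputable def balancedTerm (r : ℝ) (j : ℕ) : ℝ :=
  poch ((1 - r) / 2) j * poch (1 / 2) j ^ 2 / (j.factorial ^ 2 * poch ((1 + r) / 2) j)

/-- A terminating case of Whipple's transformation. -/
lemma sum_wellPoised_eq_sum_balanced {r : ℝ} (hr : 0 < r) (n : ℕ) :
    ∑ k ∈ Finset.range (n + 1),
        (-1 : ℝ) ^ k * wellPoisedTerm r k / ((n - k).factorial * poch (1 + r) (n + k))
      = (∑ j ∈ Finset.range (n + 1), balancedTerm r j * (poch r (n - j) / (n - j).factorial))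
          / poch (r + 1 / 2) n ^ 2 := by
  set f : ℕ → ℕ → ℝ := fun j i =>
    (-1 : ℝ) ^ i * poch r (j + i + j) * poch ((1 - r) / 2) j * poch (1 / 2) (j + i) ^ 2
      * (r + 2 * (j + i : ℕ)) / (j.factorial ^ 2 * poch ((1 + r) / 2) j * i.factorial * r
      * poch (r + 1 / 2) (j + i) ^ 2 * (n - (j + i)).factorial * poch (1 + r) (n + (j + i)))
    with hf
  have hdiag : ∀ k ∈ Finset.range (n + 1),
      (-1 : ℝ) ^ k * wellPoisedTerm r k / ((n - k).factorial * poch (1 + r) (n + k))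
        = ∑ j ∈ Finset.range (k + 1), f j (k - j) := by
    intro k hk
    have h1 : poch (r + 1 / 2) k ≠ 0 := (poch_pos (by linarith) _).ne'
    have h2 : poch (1 + r) (n + k) ≠ 0 := (poch_pos (by linarith) _).ne'
    have h3 : (k.factorial : ℝ) ≠ 0 := by positivity
    have h4 : ((n - k).factorial : ℝ) ≠ 0 := by positivity
    have hS := sum_saalschutz hr k
    have : (-1 : ℝ) ^ k * wellPoisedTerm r k / ((n - k).factorial * poch (1 + r) (n + k))
        = (poch r k ^ 2 / k.factorial) * ((-1 : ℝ) ^ k * poch (1 / 2) k ^ 2 * (r + 2 * k)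
          / (r * poch (r + 1 / 2) k ^ 2 * k.factorial * (n - k).factorial
            * poch (1 + r) (n + k))) := by
      rw [wellPoisedTerm]; field_simp
    rw [this, ← hS, Finset.sum_mul]
    refine Finset.sum_congr rfl fun j hj => ?_
    have hjk : j ≤ k := by simpa [Nat.lt_succ_iff] using hj
    have h5 : poch ((1 + r) / 2) j ≠ 0 := (poch_pos (by linarith) _).ne'
    have h6 : (j.factorial : ℝ) ≠ 0 := by positivity
    have h7 : ((k - j).factorial : ℝ) ≠ 0 := by positivity
    have hsgn : (-1 : ℝ) ^ (k - j) = (-1) ^ k * (-1) ^ j := by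
      obtain ⟨i, rfl⟩ := Nat.exists_eq_add_of_le hjk
      rw [Nat.add_sub_cancel_left, pow_add, mul_right_comm, ← mul_pow]
      simp
    simp only [hf]
    rw [Nat.cast_choose ℝ hjk, Nat.add_sub_cancel' hjk, hsgn]
    field_simp
  rw [Finset.sum_congr rfl hdiag, Finset.sum_range_diag_flip, Finset.sum_div]
  refine Finset.sum_congr rfl fun j hj => ?_
  have hjn : j ≤ n := by simpa [Nat.lt_succ_iff] using hj
  obtain ⟨m, rfl⟩ := Nat.exists_eq_add_of_le hjn
  have hV := sum_veryWellPoised (A := r + 2 * j) (d := 1 / 2 + j) (c := r + 1 / 2 + j) (s := r)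
    (by positivity) (by positivity) (by ring) (by ring) m
  have e1 : j + m + 1 - j = m + 1 := by omega
  have e2 : j + m - j = m := by omega
  have hr1 : poch (r + 1 / 2) j ≠ 0 := (poch_pos (by linarith) _).ne'
  have hr2 : poch (r + 1 / 2 + j) m ≠ 0 := (poch_pos (by positivity) _).ne'
  have hr3 : poch ((1 + r) / 2) j ≠ 0 := (poch_pos (by linarith) _).ne'
  have hr4 : poch (1 + r) (j + j) ≠ 0 := (poch_pos (by linarith) _).ne'
  have hr5 : (j.factorial : ℝ) ≠ 0 := by positivity
  have hr6 : (m.factorial : ℝ) ≠ 0 := by positivity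
  have hA : r + 2 * j ≠ 0 := by positivity
  have hr7 : poch r (j + j) = r * poch (1 + r) (j + j) / (r + 2 * j) := by
    rw [mul_poch_one_add, eq_div_iff hA]; push_cast; ring
  rw [e1, e2]
  have : ∀ i ∈ Finset.range (m + 1), f j i
      = ((-1 : ℝ) ^ i * m.choose i * poch (r + 2 * j) i * (r + 2 * j + 2 * i)
        * poch (1 / 2 + j) i ^ 2
        / (poch (r + 1 / 2 + j) i ^ 2 * poch (1 + (r + 2 * j)) (m + i)))
        * (poch ((1 - r) / 2) j * poch (1 / 2) j ^ 2 / (j.factorial ^ 2 * poch ((1 + r) / 2) j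
          * m.factorial * poch (r + 1 / 2) j ^ 2 * (r + 2 * j))) := by
    intro i hi
    have him : i ≤ m := by simpa [Nat.lt_succ_iff] using hi
    have h1 : poch (r + 1 / 2 + j) i ≠ 0 := (poch_pos (by positivity) _).ne'
    have h2 : poch (1 + (r + 2 * j)) (m + i) ≠ 0 := (poch_pos (by positivity) _).ne'
    have h3 : (i.factorial : ℝ) ≠ 0 := by positivity
    have h4 : ((m - i).factorial : ℝ) ≠ 0 := by positivity
    simp only [hf]
    rw [Nat.cast_choose ℝ him, show j + m - (j + i) = m - i by omega,
      show j + i + j = j + j + i by ring, show j + m + (j + i) = j + j + (m + i) by ring,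
      poch_add r (j + j), poch_add (1 / 2) j i, poch_add (r + 1 / 2) j i,
      poch_add (1 + r) (j + j), hr7,
      show r + ((j + j : ℕ) : ℝ) = r + 2 * j by push_cast; ring,
      show 1 + r + ((j + j : ℕ) : ℝ) = 1 + (r + 2 * j) by push_cast; ring]
    push_cast
    field_simp
    ring
  rw [Finset.sum_congr rfl this, ← Finset.sum_mul, hV, poch_add (r + 1 / 2) j m, balancedTerm]
  field_simp

lemma alternating_sum_mem {b : ℕ → ℝ} (hb : Antitone b) (hb0 : ∀ n, 0 ≤ b n) (n : ℕ) :
    0 ≤ ∑ i ∈ Finset.range n, (-1 : ℝ) ^ i * b i ∧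
      ∑ i ∈ Finset.range n, (-1 : ℝ) ^ i * b i ≤ b 0 := by
  induction n generalizing b with
  | zero => simpa using hb0 0
  | succ n ih =>
    obtain ⟨h1, h2⟩ := ih (b := fun i => b (i + 1)) (fun i j h => hb (by omega)) fun i => hb0 _
    have e : ∑ i ∈ Finset.range (n + 1), (-1 : ℝ) ^ i * b i
        = b 0 - ∑ i ∈ Finset.range n, (-1 : ℝ) ^ i * b (i + 1) := by
      rw [Finset.sum_range_succ', sub_eq_add_neg, ← Finset.sum_neg_distrib, add_comm]
      simp [pow_succ]
    have := hb (Nat.zero_le 1)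
    simp only [zero_add] at h2
    rw [e]
    constructor <;> linarith

lemma abs_alternating_sum_sub_le {b : ℕ → ℝ} (hb : Antitone b) (hb0 : ∀ n, 0 ≤ b n) {M N : ℕ}
    (h : M ≤ N) :
    |∑ i ∈ Finset.range N, (-1 : ℝ) ^ i * b i - ∑ i ∈ Finset.range M, (-1 : ℝ) ^ i * b i|
      ≤ b M := by
  obtain ⟨k, rfl⟩ := Nat.exists_eq_add_of_le h
  obtain ⟨h1, h2⟩ := alternating_sum_mem (b := fun i => b (M + i)) (fun i j h => hb (by omega))
    (fun i => hb0 _) k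
  rw [Finset.sum_range_add, add_sub_cancel_left]
  simp only [pow_add, mul_assoc]
  rw [← Finset.mul_sum, abs_mul, abs_pow, abs_neg, abs_one, one_pow, one_mul, abs_of_nonneg h1]
  simpa using h2

/-- Weighted partial sums of an alternating series, with monotone weights tending to `1`,
converge to the sum of the series. -/
lemma tendsto_weighted_alternating_sum {a : ℕ → ℝ} (ha : Antitone a)
    (ha0 : Tendsto a atTop (𝓝 0)) {c : ℕ → ℕ → ℝ} (hc : ∀ n, Antitone (c n))
    (hc0 : ∀ n k, 0 ≤ c n k) (hc1 : ∀ n, c n 0 = 1)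
    (hlim : ∀ k, Tendsto (fun n => c n k) atTop (𝓝 1)) {L : ℝ}
    (hL : Tendsto (fun N => ∑ k ∈ Finset.range N, (-1 : ℝ) ^ k * a k) atTop (𝓝 L)) :
    Tendsto (fun n => ∑ k ∈ Finset.range (n + 1), (-1 : ℝ) ^ k * (a k * c n k)) atTop (𝓝 L) := by
  have hapos : ∀ k, 0 ≤ a k := fun k => ha.le_of_tendsto ha0 k
  rw [Metric.tendsto_atTop']
  intro ε hε
  obtain ⟨M, hM⟩ := (ha0.eventually (gt_mem_nhds (show (0 : ℝ) < ε / 3 by positivity))).exists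
  have hLM : |L - ∑ k ∈ Finset.range M, (-1 : ℝ) ^ k * a k| ≤ a M := by
    refine le_of_tendsto ((hL.sub_const _).abs) ?_
    filter_upwards [eventually_ge_atTop M] with N hN
    exact abs_alternating_sum_sub_le ha hapos hN
  have hfin : Tendsto (fun n => ∑ k ∈ Finset.range M, (-1 : ℝ) ^ k * (a k * c n k)) atTop
      (𝓝 (∑ k ∈ Finset.range M, (-1 : ℝ) ^ k * a k)) := by
    refine tendsto_finsetSum _ fun k _ => ?_
    simpa using ((hlim k).const_mul (a k)).const_mul ((-1 : ℝ) ^ k)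
  have hev := (Metric.tendsto_nhds.mp hfin) (ε / 3) (by positivity)
  obtain ⟨N, hN⟩ := eventually_atTop.mp hev
  refine ⟨max M N, fun n hn => ?_⟩
  have h1 := hN n (by omega)
  have h2 := abs_alternating_sum_sub_le (b := fun k => a k * c n k)
    (fun i j h => mul_le_mul (ha h) (hc n h) (hc0 _ _) (hapos _))
    (fun k => mul_nonneg (hapos k) (hc0 n k)) (show M ≤ n + 1 by omega)
  have h3 : a M * c n M ≤ a M := by
    have : c n M ≤ 1 := (hc n (Nat.zero_le M)).trans_eq (hc1 n)
    exact mul_le_of_le_one_right (hapos M) this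
  rw [Real.dist_eq] at h1 ⊢
  rw [abs_lt] at *
  rw [abs_le] at *
  constructor <;> linarith [h1.1, h1.2, h2.1, h2.2, hLM.1, hLM.2]

/-- If the convolution of a nonnegative sequence `t` with a positive antitone sequence `v` of
divergent sum is asymptotic to `ℓ • v`, then `t` sums to `ℓ`. -/
lemma hasSum_of_tendsto_convolution_div {t v : ℕ → ℝ} (ht : ∀ n, 0 ≤ t n) (hv : Antitone v)
    (hv0 : ∀ n, 0 < v n)
    (hvs : Tendsto (fun N => ∑ n ∈ Finset.range N, v n) atTop atTop) {l : ℝ}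
    (h : Tendsto (fun n => (∑ j ∈ Finset.range (n + 1), t j * v (n - j)) / v n) atTop (𝓝 l)) :
    HasSum t l := by
  have hle : ∀ N, ∑ j ∈ Finset.range N, t j ≤ l := by
    intro N
    refine ge_of_tendsto h ?_
    filter_upwards [eventually_ge_atTop N] with n hn
    rw [le_div_iff₀ (hv0 n), Finset.sum_mul]
    calc ∑ j ∈ Finset.range N, t j * v n
        ≤ ∑ j ∈ Finset.range N, t j * v (n - j) :=
          Finset.sum_le_sum fun j _ => mul_le_mul_of_nonneg_left (hv (Nat.sub_le n j)) (ht j)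
      _ ≤ _ := Finset.sum_le_sum_of_subset_of_nonneg
          (Finset.range_subset_range.mpr (by omega))
          fun j _ _ => mul_nonneg (ht j) (hv0 _).le
  have hsum : Summable t := summable_of_sum_range_le ht hle
  have hT : ∑' j, t j ≤ l := hsum.tsum_le_of_sum_range_le hle
  set T := ∑' j, t j with hTdef
  suffices l ≤ T by
    rw [← le_antisymm hT this]; exact hsum.hasSum
  by_contra! hlt
  set e := (l - T) / 2 with he
  have hepos : 0 < e := by rw [he]; linarith
  obtain ⟨M, hM⟩ := eventually_atTop.mp (h.eventually (lt_mem_nhds (show T + e < l by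
    rw [he]; linarith)))
  set u : ℕ → ℝ := fun n => ∑ j ∈ Finset.range (n + 1), t j * v (n - j) with hu
  have hupper : ∀ N, ∑ n ∈ Finset.range N, u n ≤ T * ∑ n ∈ Finset.range N, v n := by
    intro N
    simp only [hu]
    rw [Finset.sum_range_diag_flip N fun j i => t j * v i]
    calc ∑ m ∈ Finset.range N, ∑ k ∈ Finset.range (N - m), t m * v k
        ≤ ∑ m ∈ Finset.range N, t m * ∑ k ∈ Finset.range N, v k := by
          refine Finset.sum_le_sum fun m _ => ?_
          rw [← Finset.mul_sum]
          exact mul_le_mul_of_nonneg_left (Finset.sum_le_sum_of_subset_of_nonneg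
            (Finset.range_subset_range.mpr (Nat.sub_le N m)) fun k _ _ => (hv0 k).le) (ht m)
      _ ≤ _ := by
          rw [← Finset.sum_mul]
          exact mul_le_mul_of_nonneg_right (hsum.sum_le_tsum _ fun j _ => ht j)
            (Finset.sum_nonneg fun k _ => (hv0 k).le)
  obtain ⟨N, hNM, hN⟩ := ((eventually_ge_atTop M).and (hvs.eventually_gt_atTop
    (-(∑ n ∈ Finset.range M, (u n - (T + e) * v n)) / e))).exists
  have hmono : ∑ n ∈ Finset.range M, (u n - (T + e) * v n)
      ≤ ∑ n ∈ Finset.range N, (u n - (T + e) * v n) := by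
    rw [← Finset.sum_range_add_sum_Ico _ hNM]
    refine le_add_of_nonneg_right (Finset.sum_nonneg fun n hn => ?_)
    have := hM n (Finset.mem_Ico.mp hn).1
    rw [lt_div_iff₀ (hv0 n)] at this
    simp only [hu]
    linarith
  rw [div_lt_iff₀ hepos] at hN
  rw [Finset.sum_sub_distrib, ← Finset.mul_sum] at hmono
  rw [Finset.sum_sub_distrib, ← Finset.mul_sum] at hmono
  have := hupper N
  rw [Finset.sum_sub_distrib, ← Finset.mul_sum] at hN
  nlinarith

lemma wellPoisedTerm_pos {r : ℝ} (hr : 0 < r) (k : ℕ) : 0 < wellPoisedTerm r k := by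
  have h1 := poch_pos hr k
  have h2 := poch_pos (show (0 : ℝ) < 1 / 2 by norm_num) k
  have h3 := poch_pos (show (0 : ℝ) < r + 1 / 2 by linarith) k
  unfold wellPoisedTerm
  positivity

lemma wellPoisedTerm_antitone {r : ℝ} (hr0 : 0 < r) (hr1 : r < 1) :
    Antitone (wellPoisedTerm r) := by
  refine antitone_nat_of_succ_le fun k => ?_
  have h1 := poch_pos hr0 k
  have h2 := poch_pos (show (0 : ℝ) < 1 / 2 by norm_num) k
  have h3 := poch_pos (show (0 : ℝ) < r + 1 / 2 by linarith) k
  have hx : 0 < r + 2 * k := by positivity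
  have hratio : wellPoisedTerm r (k + 1) = wellPoisedTerm r k *
      (((r + k) * (1 / 2 + k)) ^ 2 * (r + 2 * k + 2)
        / (((r + 1 / 2 + k) * (k + 1)) ^ 2 * (r + 2 * k))) := by
    have h4 : r + 1 / 2 + k ≠ 0 := by positivity
    unfold wellPoisedTerm
    simp only [poch_succ, Nat.factorial_succ]
    push_cast
    generalize poch (r + 1 / 2) k = Y at *
    field_simp
    ring
  rw [hratio]
  refine mul_le_of_le_one_right (wellPoisedTerm_pos hr0 k).le ?_
  rw [div_le_one (by positivity)]
  obtain ⟨x, hxd⟩ : ∃ x : ℝ, x = k + r / 2 := ⟨_, rfl⟩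
  obtain ⟨q, hq⟩ : ∃ q : ℝ, q = r * (1 - r) / 4 := ⟨_, rfl⟩
  have hx0 : 0 < x := by rw [hxd]; positivity
  have hq0 : 0 ≤ q := by rw [hq]; nlinarith
  have hk : (0 : ℝ) ≤ k := k.cast_nonneg
  have hqx : q ≤ x / 2 := by rw [hq, hxd]; nlinarith
  have e1 : (r + k) * (1 / 2 + k) = x * (x + 1 / 2) + q := by rw [hxd, hq]; ring
  have e2 : (r + 1 / 2 + k) * (k + 1) = (x + 1) * (x + 1 / 2) + q := by rw [hxd, hq]; ring
  have e3 : r + 2 * k = 2 * x := by rw [hxd]; ring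
  rw [e1, e2, e3]
  have hq2 : q ^ 2 ≤ x ^ 2 / 4 := by nlinarith
  have hdiff : ((x + 1) * (x + 1 / 2) + q) ^ 2 * (2 * x) - (x * (x + 1 / 2) + q) ^ 2 * (2 * x + 2)
      = 2 * (x * (x + 1) * (x + 1 / 2) ^ 2 - q ^ 2) := by ring
  have : x ^ 2 / 4 ≤ x * (x + 1) * (x + 1 / 2) ^ 2 := by
    have : 0 ≤ x * (x * x * x + 2 * x * x + x + 1 / 4) := by positivity
    nlinarith
  linarith

lemma poch_succ_eq_div_gammaSeq {s : ℝ} (hs : 0 < s) {n : ℕ} (hn : 0 < n) :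
    poch s (n + 1) = (n : ℝ) ^ s * n.factorial / GammaSeq s n := by
  have : ∀ m, poch s m = ∏ j ∈ Finset.range m, (s + j) := by
    intro m
    induction m with
    | zero => simp [poch_zero]
    | succ m ih => rw [poch_succ, ih, Finset.prod_range_succ]
  rw [GammaSeq, ← this]
  have h1 := (poch_pos hs (n + 1)).ne'
  have h2 : (n : ℝ) ^ s ≠ 0 := (rpow_pos_of_pos (by exact_mod_cast hn) s).ne'
  have h3 : (n.factorial : ℝ) ≠ 0 := by positivity
  field_simp

lemma tendsto_wellPoisedTerm {r : ℝ} (hr : 0 < r) :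
    Tendsto (wellPoisedTerm r) atTop (𝓝 0) := by
  rw [← tendsto_add_atTop_iff_nat 1]
  have hG := ((GammaSeq_tendsto_Gamma (r + 1 / 2)).div
    ((GammaSeq_tendsto_Gamma r).mul (GammaSeq_tendsto_Gamma (1 / 2)))
    (mul_pos (Gamma_pos_of_pos hr) (Gamma_pos_of_pos (by norm_num))).ne').pow 2
  have h0 : Tendsto (fun n : ℕ => 1 / ((n : ℝ) + 1)) atTop (𝓝 0) :=
    tendsto_one_div_add_atTop_nhds_zero_nat
  have hlim := hG.mul ((h0.pow 2).add (h0.const_mul (2 / r)))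
  have hzero : (0 : ℝ) ^ 2 + 2 / r * 0 = 0 := by simp
  rw [hzero, mul_zero] at hlim
  refine hlim.congr' ?_
  filter_upwards [eventually_gt_atTop 0] with n hn
  have hn' : (0 : ℝ) < n := by exact_mod_cast hn
  have hpow : (n : ℝ) ^ (r + 1 / 2) = (n : ℝ) ^ r * (n : ℝ) ^ (1 / 2 : ℝ) := rpow_add hn' _ _
  have hg : ∀ s : ℝ, 0 < s → GammaSeq s n ≠ 0 := by
    intro s hs h
    have := poch_succ_eq_div_gammaSeq hs hn
    rw [h, div_zero] at this
    exact (poch_pos hs _).ne' this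
  have h1 := hg r hr
  have h2 := hg (1 / 2) (by norm_num)
  have h3 := hg (r + 1 / 2) (by linarith)
  have h4 : (n : ℝ) ^ r ≠ 0 := (rpow_pos_of_pos hn' _).ne'
  have h5 : (n : ℝ) ^ (1 / 2 : ℝ) ≠ 0 := (rpow_pos_of_pos hn' _).ne'
  have h6 : (n.factorial : ℝ) ≠ 0 := by positivity
  simp only [Pi.div_apply, wellPoisedTerm]
  rw [poch_succ_eq_div_gammaSeq hr hn, poch_succ_eq_div_gammaSeq (by norm_num) hn,
    poch_succ_eq_div_gammaSeq (by linarith) hn, hpow, Nat.factorial_succ]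
  push_cast
  generalize GammaSeq (r + 1 / 2) n = g at *
  generalize GammaSeq (1 / 2) n = g' at *
  generalize (n : ℝ) ^ (1 / 2 : ℝ) = w at *
  field_simp

lemma tendsto_poch_ratio {r : ℝ} (hr : 0 < r) :
    Tendsto (fun n => poch r n * poch (1 + r) n / poch (r + 1 / 2) n ^ 2) atTop
      (𝓝 (Gamma (r + 1 / 2) ^ 2 / (Gamma r * Gamma (1 + r)))) := by
  rw [← tendsto_add_atTop_iff_nat 1]
  have hG := ((GammaSeq_tendsto_Gamma (r + 1 / 2)).pow 2).div
    ((GammaSeq_tendsto_Gamma r).mul (GammaSeq_tendsto_Gamma (1 + r)))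
    (mul_pos (Gamma_pos_of_pos hr) (Gamma_pos_of_pos (by linarith))).ne'
  refine hG.congr' ?_
  filter_upwards [eventually_gt_atTop 0] with n hn
  have hn' : (0 : ℝ) < n := by exact_mod_cast hn
  have hpow : ((n : ℝ) ^ (r + 1 / 2)) ^ 2 = (n : ℝ) ^ r * (n : ℝ) ^ (1 + r) := by
    rw [pow_two, ← rpow_add hn', ← rpow_add hn']; congr 1; ring
  have h4 : (n : ℝ) ^ r ≠ 0 := (rpow_pos_of_pos hn' _).ne'
  have h5 : (n : ℝ) ^ (1 + r) ≠ 0 := (rpow_pos_of_pos hn' _).ne'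
  have h6 : (n.factorial : ℝ) ≠ 0 := by positivity
  simp only [Pi.div_apply]
  rw [poch_succ_eq_div_gammaSeq hr hn, poch_succ_eq_div_gammaSeq (by linarith) hn,
    poch_succ_eq_div_gammaSeq (by linarith) hn, div_pow, mul_pow, hpow]
  generalize GammaSeq (r + 1 / 2) n = g at *
  field_simp

/-- The sum of the well-poised series as a multiple of a balanced `₃F₂`: a nonterminating case
of Whipple's transformation. -/
lemma hasSum_balancedTerm {r : ℝ} (hr0 : 0 < r) (hr1 : r < 1) {L : ℝ}
    (hL : Tendsto (fun N => ∑ k ∈ Finset.range N, (-1 : ℝ) ^ k * wellPoisedTerm r k) atTop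
      (𝓝 L)) :
    HasSum (balancedTerm r) (L / (Gamma (r + 1 / 2) ^ 2 / (Gamma r * Gamma (1 + r)))) := by
  set c : ℕ → ℕ → ℝ := fun n k => n.descFactorial k / poch (1 + r + n) k with hc
  have hpos : ∀ n k : ℕ, 0 < poch (1 + r + n) k := fun n k => poch_pos (by positivity) k
  have hc0 : ∀ n k, 0 ≤ c n k := fun n k => div_nonneg (Nat.cast_nonneg _) (hpos n k).le
  have hcs : ∀ n k, c n (k + 1) = c n k * (((n - k : ℕ) : ℝ) / (1 + r + n + k)) := by
    intro n k
    simp only [hc]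
    rw [Nat.descFactorial_succ, poch_succ, Nat.cast_mul, mul_comm ((n - k : ℕ) : ℝ),
      mul_div_mul_comm]
  have hanti : ∀ n, Antitone (c n) := by
    refine fun n => antitone_nat_of_succ_le fun k => ?_
    rw [hcs]
    refine mul_le_of_le_one_right (hc0 n k) ?_
    rw [div_le_one (by positivity)]
    have h1 : ((n - k : ℕ) : ℝ) ≤ n := by exact_mod_cast Nat.sub_le n k
    have h2 : (0 : ℝ) ≤ k := k.cast_nonneg
    linarith
  have hlim : ∀ k, Tendsto (fun n => c n k) atTop (𝓝 1) := by
    intro k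
    induction k with
    | zero => simp [hc, poch_zero]
    | succ k ih =>
      simp only [hcs]
      have : Tendsto (fun n : ℕ => ((n - k : ℕ) : ℝ) / (1 + r + n + k)) atTop (𝓝 1) := by
        rw [← tendsto_add_atTop_iff_nat k]
        have := tendsto_natCast_div_add_atTop (𝕜 := ℝ) (1 + r + 2 * k)
        refine this.congr fun n => ?_
        rw [Nat.add_sub_cancel]
        push_cast
        congr 1
        ring
      simpa using ih.mul this
  have hmain := tendsto_weighted_alternating_sum (wellPoisedTerm_antitone hr0 hr1)
    (tendsto_wellPoisedTerm hr0) hanti hc0 (fun n => by simp [hc, poch_zero]) hlim hL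
  have hkappa := tendsto_poch_ratio hr0
  have hkpos : 0 < Gamma (r + 1 / 2) ^ 2 / (Gamma r * Gamma (1 + r)) := by
    have h1 := Gamma_pos_of_pos hr0
    have h2 := Gamma_pos_of_pos (show 0 < 1 + r by linarith)
    have h3 := Gamma_pos_of_pos (show 0 < r + 1 / 2 by linarith)
    positivity
  have hv0 : ∀ n, 0 < poch r n / n.factorial := fun n =>
    div_pos (poch_pos hr0 n) (by positivity)
  refine hasSum_of_tendsto_convolution_div (v := fun n => poch r n / n.factorial) ?_ ?_ hv0 ?_ ?_
  · intro j
    have h1 := poch_pos (show 0 < (1 - r) / 2 by linarith) j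
    have h2 := poch_pos (show 0 < (1 + r) / 2 by linarith) j
    unfold balancedTerm
    positivity
  · refine antitone_nat_of_succ_le fun n => ?_
    have : poch r (n + 1) / (n + 1).factorial
        = poch r n / n.factorial * ((r + n) / (n + 1)) := by
      rw [poch_succ, Nat.factorial_succ]; push_cast; field_simp
    rw [this]
    refine mul_le_of_le_one_right (hv0 n).le ?_
    rw [div_le_one (by positivity)]
    linarith
  · rw [← not_summable_iff_tendsto_nat_atTop_of_nonneg fun n => (hv0 n).le]
    intro hs
    have hle : ∀ n : ℕ, r * (1 / ((n : ℝ) + 1)) ≤ poch r (n + 1) / (n + 1).factorial := by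
      intro n
      induction n with
      | zero => simp [poch_succ, poch_zero]
      | succ n ih =>
        have : poch r (n + 1 + 1) / (n + 1 + 1).factorial
            = poch r (n + 1) / (n + 1).factorial * ((r + (n + 1)) / (n + 1 + 1)) := by
          rw [poch_succ r (n + 1), Nat.factorial_succ (n + 1)]; push_cast; field_simp
        rw [this]
        calc r * (1 / (((n + 1 : ℕ) : ℝ) + 1))
            = r * (1 / ((n : ℝ) + 1)) * ((n + 1) / (n + 1 + 1)) := by push_cast; field_simp
          _ ≤ _ := mul_le_mul ih (div_le_div_of_nonneg_right (by linarith) (by positivity))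
            (by positivity) (hv0 _).le
    have h1 : Summable fun n : ℕ => r * (1 / ((n : ℝ) + 1)) :=
      Summable.of_nonneg_of_le (fun n => by positivity) hle ((summable_nat_add_iff 1).mpr hs)
    have h2 : Summable fun n : ℕ => 1 / (((n + 1 : ℕ) : ℝ)) := by
      simpa using (summable_mul_left_iff hr0.ne').mp h1
    exact not_summable_one_div_natCast ((summable_nat_add_iff 1).mp h2)
  · refine (hmain.div hkappa hkpos.ne').congr fun n => ?_
    have h1 := poch_pos hr0 n
    have h2 := poch_pos (show 0 < 1 + r by linarith) n
    have h3 := poch_pos (show 0 < r + 1 / 2 by linarith) n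
    have hfac : (0 : ℝ) < n.factorial := by positivity
    have hsum : ∑ k ∈ Finset.range (n + 1), (-1 : ℝ) ^ k * (wellPoisedTerm r k * c n k)
        = n.factorial * poch (1 + r) n * ∑ k ∈ Finset.range (n + 1),
          (-1 : ℝ) ^ k * wellPoisedTerm r k / ((n - k).factorial * poch (1 + r) (n + k)) := by
      rw [Finset.mul_sum]
      refine Finset.sum_congr rfl fun k hk => ?_
      have hkn : k ≤ n := by simpa [Nat.lt_succ_iff] using hk
      have hfd : ((n - k).factorial : ℝ) * n.descFactorial k = n.factorial := by
        exact_mod_cast Nat.factorial_mul_descFactorial hkn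
      have h4 := (hpos n k).ne'
      have h5 : ((n - k).factorial : ℝ) ≠ 0 := by positivity
      simp only [hc]
      rw [← hfd, poch_add (1 + r) n k]
      field_simp
    simp only [Pi.div_apply]
    rw [hsum, sum_wellPoised_eq_sum_balanced hr0]
    generalize poch (r + 1 / 2) n = Y at *
    field_simp

/-- Partial sums of the very well-poised series
`₅F₄(r, 1+r/2, r, 1/2, 1/2; r/2, 1, r+1/2, r+1/2; −1)` converge, and the limit
satisfies the stated period identity. -/
theorem veryWellPoised_5F4_period (r : ℝ) (hr0 : 0 < r) (hr1 : r < 1)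
    (S : ℕ → ℝ)
    (hS : ∀ N : ℕ, S N = ∑ k ∈ Finset.range N,
        (-1 : ℝ) ^ k * poch r k ^ 2 * poch (1 + r/2) k * poch (1/2) k ^ 2
          / (poch (r/2) k * poch (r + 1/2) k ^ 2 * (k.factorial : ℝ) ^ 2)) :
    ∃ L : ℝ, Filter.Tendsto S Filter.atTop (nhds L) ∧
      betaR r (1 - r) * betaR r (1/2) ^ 2 * L
        = -((2 : ℝ) ^ (-(2 * r))) * betaR (-r/2) r * betaR (1/2) (1/2)
            * betaR ((1 - r)/2) r * F32 (1/2) (1/2) ((1 - r)/2) 1 ((1 + r)/2) 1 := by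
  have hterm : ∀ k : ℕ, (-1 : ℝ) ^ k * poch r k ^ 2 * poch (1 + r/2) k * poch (1/2) k ^ 2
      / (poch (r/2) k * poch (r + 1/2) k ^ 2 * (k.factorial : ℝ) ^ 2)
      = (-1 : ℝ) ^ k * wellPoisedTerm r k := by
    intro k
    have h1 := (poch_pos (show 0 < r / 2 by linarith) k).ne'
    have h2 := (poch_pos (show 0 < r + 1 / 2 by linarith) k).ne'
    have h3 : (k.factorial : ℝ) ≠ 0 := by positivity
    have h4 : poch (1 + r / 2) k = poch (r / 2) k * (r + 2 * k) / r := by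
      rw [eq_div_iff hr0.ne']
      linear_combination 2 * mul_poch_one_add (r / 2) k
    rw [h4, wellPoisedTerm]
    generalize poch (r + 1 / 2) k = Y at *
    field_simp
  obtain ⟨L, hL⟩ := (wellPoisedTerm_antitone hr0 hr1).tendsto_alternating_series_of_tendsto_zero
    (tendsto_wellPoisedTerm hr0)
  have hS' : S = fun N => ∑ k ∈ Finset.range N, (-1 : ℝ) ^ k * wellPoisedTerm r k := by
    funext N
    rw [hS N]
    exact Finset.sum_congr rfl fun k _ => hterm k
  refine ⟨L, hS' ▸ hL, ?_⟩
  have hF : F32 (1/2) (1/2) ((1 - r)/2) 1 ((1 + r)/2) 1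
      = L / (Gamma (r + 1 / 2) ^ 2 / (Gamma r * Gamma (1 + r))) := by
    rw [← (hasSum_balancedTerm hr0 hr1 hL).tsum_eq, F32]
    refine tsum_congr fun k => ?_
    rw [poch_one, one_pow, mul_one, balancedTerm]
    congr 1 <;> ring
  have g1 := Gamma_pos_of_pos hr0
  have g2 := Gamma_pos_of_pos (show 0 < r + 1 / 2 by linarith)
  have g3 := Gamma_pos_of_pos (show 0 < r / 2 by linarith)
  have g4 := Gamma_pos_of_pos (show 0 < (1 + r) / 2 by linarith)
  have d1 := Gamma_mul_Gamma_add_half (r / 2)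
  have d2 := Gamma_mul_Gamma_add_half (-r / 2)
  have s1 : Gamma (1 + r) = r * Gamma r := by rw [add_comm, Gamma_add_one hr0.ne']
  have s2 : Gamma (1 - r) = -r * Gamma (-r) := by
    rw [← Gamma_add_one (neg_ne_zero.mpr hr0.ne')]; congr 1; ring
  have p1 : (2 : ℝ) ^ (1 - r) = 2 * (2 : ℝ) ^ (-r) := by
    rw [sub_eq_add_neg, rpow_add two_pos, rpow_one]
  have p2 : (2 : ℝ) ^ (1 + r) = 2 * ((2 : ℝ) ^ (-r))⁻¹ := by
    rw [rpow_add two_pos, rpow_one, rpow_neg two_pos.le, inv_inv]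
  have p3 : (2 : ℝ) ^ (-(2 * r)) = ((2 : ℝ) ^ (-r)) ^ 2 := by
    rw [pow_two, ← rpow_add two_pos]; congr 1; ring
  rw [show r / 2 + 1 / 2 = (1 + r) / 2 by ring, show 2 * (r / 2) = r by ring, p1] at d1
  rw [show -r / 2 + 1 / 2 = (1 - r) / 2 by ring, show 2 * (-r / 2) = -r by ring, sub_neg_eq_add,
    p2] at d2
  have hw : (0 : ℝ) < (2 : ℝ) ^ (-r) := rpow_pos_of_pos two_pos _
  have hsp : 0 < √π := sqrt_pos.mpr pi_pos
  have e1 : r + (1 - r) = 1 := by ring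
  have e2 : (1 : ℝ) / 2 + 1 / 2 = 1 := by ring
  have e3 : -r / 2 + r = r / 2 := by ring
  have e4 : (1 - r) / 2 + r = (1 + r) / 2 := by ring
  rw [hF]
  simp only [betaR]
  rw [e1, e2, e3, e4, Gamma_one, Gamma_one_half_eq, s1, s2, p3]
  have key : -((2 : ℝ) ^ (-r)) ^ 2 * (Gamma (-r / 2) * Gamma r / Gamma (r / 2))
      * (√π * √π / 1) * (Gamma ((1 - r) / 2) * Gamma r / Gamma ((1 + r) / 2))
      = -√π ^ 2 * Gamma r * Gamma (-r) := by
    have : -((2 : ℝ) ^ (-r)) ^ 2 * (Gamma (-r / 2) * Gamma r / Gamma (r / 2))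
      * (√π * √π / 1) * (Gamma ((1 - r) / 2) * Gamma r / Gamma ((1 + r) / 2))
      = -((2 : ℝ) ^ (-r)) ^ 2 * √π ^ 2 * Gamma r ^ 2 * (Gamma (-r / 2) * Gamma ((1 - r) / 2))
        / (Gamma (r / 2) * Gamma ((1 + r) / 2)) := by
      generalize Gamma (r / 2) = x at *
      generalize Gamma ((1 + r) / 2) = y at *
      field_simp
    rw [this, d1, d2]
    field_simp
  rw [key]
  generalize Gamma (r + 1 / 2) = Y at *
  field_simp
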